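/- There exists a universal constant C₁ > 0 with the following property. Let N ≥ 2, let y ∈ {−1, 1}^N, let f ∈ (0, 1/2], and set m = ⌈Nf⌉ and assume m < N. Let K̃ be a real symmetric positive semidefinite N×N matrix, C > 0, and consider the hypothesis class ℱ = {K̃β : β ∈ ℝ^N, ‖β‖_∞ ≤ C}. Let ρ > 0, B > 0, and let ℓ : {−1,1} × ℝ → [0, B] satisfy |ℓ(y, t) − ℓ(y, t')| ≤ (1/ρ)|t − t'| for all y, t, t'. Set p = f(1−f) and let R = (1/N) E_γ[ sup_{‖β‖_∞ ≤ C} βᵀ K̃ γ ], where γ = (γ_1,…,γ_N) are independent random variables each taking the value 1 with probability p, the value −1 with probability p, and the value 0 with probability 1−2p. Then for every δ ∈ (0, 1), with probability at least 1 − δ over the choice of a subset S ⊆ {1,…,N} drawn uniformly at random among all subsets of size m, the following holds simultaneously for all F ∈ ℱ: (1/(N−m)) Σ_{k ∉ S} ℓ(y_k, F_k) ≤ (1/m) Σ_{k ∈ S} ℓ(y_k, F_k) + R/(ρ f(1−f)) + C₁ B (1 + √(ln(1/δ))) / ((1−f)√(Nf)). -/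

import Mathlib

noncomputable section
open Finset Matrix
open scoped Classical

/-- The three possible outcomes of a transductive-Rademacher variable have
probabilities `p`, `p`, `1 - 2p` ... -/
def radW (p : ℝ) : Fin 3 → ℝ := ![p, p, 1 - 2 * p]

/-- ... and values `1`, `-1`, `0` respectively. -/
def radV : Fin 3 → ℝ := ![1, -1, 0]

/-- Expectation of `h γ` where `γ = (γ_1, …, γ_N)` (indexed by `ι`) is a vector of i.i.d.
random variables taking value `1` w.p. `p`, `-1` w.p. `p` and `0` w.p. `1 - 2p`. -/
def radExp {ι : Type*} [Fintype ι] [DecidableEq ι] (p : ℝ) (h : (ι → ℝ) → ℝ) : ℝ :=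
  ∑ g : ι → Fin 3, (∏ k, radW p (g k)) * h (fun k => radV (g k))

/-- The average of `g` over the subsets of `A` with `m` elements. -/
def sliceAvg {ι : Type*} (m : ℕ) (A : Finset ι) (g : Finset ι → ℝ) : ℝ :=
  (∑ S ∈ A.powersetCard m, g S) / (A.card.choose m : ℝ)

section Slice

variable {ι : Type*}

lemma sliceAvg_mono {m : ℕ} {A : Finset ι} {g h : Finset ι → ℝ}
    (hgh : ∀ S ∈ A.powersetCard m, g S ≤ h S) : sliceAvg m A g ≤ sliceAvg m A h :=
  div_le_div_of_nonneg_right (Finset.sum_le_sum hgh) (Nat.cast_nonneg _)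

lemma sliceAvg_const {m : ℕ} {A : Finset ι} (hm : m ≤ A.card) (c : ℝ) :
    sliceAvg m A (fun _ => c) = c := by
  have h1 : (0 : ℝ) < A.card.choose m := by exact_mod_cast Nat.choose_pos hm
  rw [sliceAvg, Finset.sum_const, Finset.card_powersetCard, nsmul_eq_mul]
  field_simp

lemma sliceAvg_add (m : ℕ) (A : Finset ι) (g h : Finset ι → ℝ) :
    sliceAvg m A (fun S => g S + h S) = sliceAvg m A g + sliceAvg m A h := by
  simp only [sliceAvg, Finset.sum_add_distrib, add_div]

lemma sliceAvg_const_mul (m : ℕ) (A : Finset ι) (c : ℝ) (g : Finset ι → ℝ) :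
    sliceAvg m A (fun S => c * g S) = c * sliceAvg m A g := by
  simp only [sliceAvg, ← Finset.mul_sum, mul_div_assoc]

lemma abs_sliceAvg_sub_le {m : ℕ} {A : Finset ι} (hm : m ≤ A.card) {g h : Finset ι → ℝ} {c : ℝ}
    (hgh : ∀ S, |g S - h S| ≤ c) : |sliceAvg m A g - sliceAvg m A h| ≤ c := by
  have h1 : sliceAvg m A g ≤ sliceAvg m A (fun S => h S + c) :=
    sliceAvg_mono fun S _ => by linarith [(abs_le.1 (hgh S)).2]
  have h2 : sliceAvg m A h ≤ sliceAvg m A (fun S => g S + c) :=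
    sliceAvg_mono fun S _ => by linarith [(abs_le.1 (hgh S)).1]
  rw [sliceAvg_add, sliceAvg_const hm] at h1 h2
  rw [abs_le]
  constructor <;> linarith

lemma exp_le_cosh_add_mul {t D : ℝ} (hD : 0 < D) (ht : |t| ≤ D) :
    Real.exp t ≤ Real.cosh D + t * (Real.sinh D / D) := by
  obtain ⟨h1, h2⟩ := abs_le.1 ht
  have h := convexOn_exp.2 (Set.mem_univ (-D)) (Set.mem_univ D)
    (show 0 ≤ (D - t) / (2 * D) by apply div_nonneg <;> linarith)
    (show 0 ≤ (D + t) / (2 * D) by apply div_nonneg <;> linarith)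
    (by field_simp; ring)
  simp only [smul_eq_mul] at h
  have e : (D - t) / (2 * D) * -D + (D + t) / (2 * D) * D = t := by field_simp; ring
  rw [e] at h
  refine h.trans (le_of_eq ?_)
  rw [Real.cosh_eq, Real.sinh_eq]
  field_simp
  ring

/-- Hoeffding's lemma for a uniform average over a finite set. -/
lemma avg_exp_le {A : Finset ι} (hA : A.Nonempty) {G : ι → ℝ} {D : ℝ}
    (hG : ∀ x ∈ A, |G x - (∑ z ∈ A, G z) / A.card| ≤ D) :
    (∑ x ∈ A, Real.exp (G x)) / A.card ≤ Real.exp ((∑ z ∈ A, G z) / A.card + D ^ 2 / 2) := by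
  have hc : (0 : ℝ) < A.card := by exact_mod_cast hA.card_pos
  set μ := (∑ z ∈ A, G z) / A.card with hμ
  have hsum : ∑ x ∈ A, (G x - μ) = 0 := by
    rw [Finset.sum_sub_distrib, Finset.sum_const, nsmul_eq_mul, hμ]
    field_simp
    ring
  rw [div_le_iff₀ hc]
  have hD : 0 ≤ D := by
    obtain ⟨x, hx⟩ := hA
    exact (abs_nonneg _).trans (hG x hx)
  have hE : ∑ x ∈ A, Real.exp (G x - μ) ≤ A.card * Real.exp (D ^ 2 / 2) := by
    rcases hD.eq_or_lt with h0 | hpos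
    · have : ∀ x ∈ A, Real.exp (G x - μ) = 1 := fun x hx => by
        have := hG x hx
        rw [← h0] at this
        rw [abs_nonpos_iff.1 this, Real.exp_zero]
      rw [Finset.sum_congr rfl this, ← h0]
      simp
    · calc ∑ x ∈ A, Real.exp (G x - μ)
          ≤ ∑ x ∈ A, (Real.cosh D + (G x - μ) * (Real.sinh D / D)) :=
            Finset.sum_le_sum fun x hx => exp_le_cosh_add_mul hpos (hG x hx)
        _ = A.card * Real.cosh D := by
            rw [Finset.sum_add_distrib, ← Finset.sum_mul, hsum]
            simp
        _ ≤ _ := mul_le_mul_of_nonneg_left (Real.cosh_le_exp_half_sq D) hc.le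
  have e : ∀ x ∈ A, Real.exp (G x) = Real.exp μ * Real.exp (G x - μ) := fun x _ => by
    rw [← Real.exp_add]; congr 1; ring
  rw [Finset.sum_congr rfl e, ← Finset.mul_sum, Real.exp_add]
  calc _ ≤ Real.exp μ * (A.card * Real.exp (D ^ 2 / 2)) :=
        mul_le_mul_of_nonneg_left hE (Real.exp_pos _).le
    _ = _ := by ring

variable [DecidableEq ι]

lemma sum_powersetCard_erase_insert (m : ℕ) (A : Finset ι) (g : Finset ι → ℝ) :
    ∑ x ∈ A, ∑ S ∈ (A.erase x).powersetCard m, g (insert x S) =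
      (m + 1 : ℝ) * ∑ S ∈ A.powersetCard (m + 1), g S := by
  have h : (m + 1 : ℝ) * ∑ S ∈ A.powersetCard (m + 1), g S =
      ∑ S ∈ A.powersetCard (m + 1), ∑ _x ∈ S, g S := by
    rw [Finset.mul_sum]
    refine Finset.sum_congr rfl fun S hS => ?_
    rw [Finset.sum_const, (Finset.mem_powersetCard.1 hS).2]
    simp
  rw [h, Finset.sum_sigma', Finset.sum_sigma']
  refine Finset.sum_bij' (fun p _ => ⟨insert p.1 p.2, p.1⟩) (fun p _ => ⟨p.2, p.1.erase p.2⟩)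
    ?_ ?_ ?_ ?_ ?_
  · rintro ⟨x, S⟩ hp
    simp only [Finset.mem_sigma, Finset.mem_powersetCard] at hp ⊢
    obtain ⟨hx, hS, hc⟩ := hp
    have hxS : x ∉ S := fun h => Finset.notMem_erase x A (hS h)
    exact ⟨⟨Finset.insert_subset hx (hS.trans (Finset.erase_subset _ _)),
      by rw [Finset.card_insert_of_notMem hxS, hc]⟩, Finset.mem_insert_self _ _⟩
  · rintro ⟨S, x⟩ hp
    simp only [Finset.mem_sigma, Finset.mem_powersetCard] at hp ⊢
    obtain ⟨⟨hS, hc⟩, hx⟩ := hp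
    exact ⟨hS hx, Finset.erase_subset_erase _ hS, by rw [Finset.card_erase_of_mem hx, hc]; rfl⟩
  · rintro ⟨x, S⟩ hp
    simp only [Finset.mem_sigma, Finset.mem_powersetCard] at hp
    have hxS : x ∉ S := fun h => Finset.notMem_erase x A (hp.2.1 h)
    simp [Finset.erase_insert hxS]
  · rintro ⟨S, x⟩ hp
    simp only [Finset.mem_sigma] at hp
    simp [Finset.insert_erase hp.2]
  · intro p _
    rfl

lemma sum_powersetCard_erase {m : ℕ} {A : Finset ι} (hm : m ≤ A.card) (g : Finset ι → ℝ) :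
    ∑ x ∈ A, ∑ S ∈ (A.erase x).powersetCard m, g S =
      (A.card - m : ℝ) * ∑ S ∈ A.powersetCard m, g S := by
  rw [Finset.sum_comm' (t' := A.powersetCard m) (s' := fun S => A \ S), Finset.mul_sum]
  · refine Finset.sum_congr rfl fun S hS => ?_
    obtain ⟨hS, hc⟩ := Finset.mem_powersetCard.1 hS
    rw [Finset.sum_const, Finset.card_sdiff_of_subset hS, hc, nsmul_eq_mul, Nat.cast_sub hm]
  · intro x S
    simp only [Finset.mem_powersetCard, Finset.mem_sdiff, Finset.subset_erase]
    tauto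

lemma sliceAvg_succ {m : ℕ} {A : Finset ι} (hm : m < A.card) (g : Finset ι → ℝ) :
    sliceAvg (m + 1) A g =
      (∑ x ∈ A, sliceAvg m (A.erase x) fun S => g (insert x S)) / A.card := by
  obtain ⟨n, hn⟩ : ∃ n, A.card = n + 1 := ⟨A.card - 1, by omega⟩
  have h : ∀ x ∈ A, sliceAvg m (A.erase x) (fun S => g (insert x S)) =
      (∑ S ∈ (A.erase x).powersetCard m, g (insert x S)) / (n.choose m : ℝ) := fun x hx => by
    rw [sliceAvg, Finset.card_erase_of_mem hx, hn]; rfl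
  rw [Finset.sum_congr rfl h, ← Finset.sum_div, sum_powersetCard_erase_insert, sliceAvg, hn]
  have h1 : (0 : ℝ) < n.choose m := by exact_mod_cast Nat.choose_pos (by omega)
  have h2 : (0 : ℝ) < (n + 1).choose (m + 1) := by exact_mod_cast Nat.choose_pos (by omega)
  have h3 : ((n + 1 : ℕ) : ℝ) * n.choose m = (n + 1).choose (m + 1) * ((m + 1 : ℕ) : ℝ) := by
    exact_mod_cast Nat.add_one_mul_choose_eq n m
  push_cast at h3 ⊢
  rw [div_div, div_eq_div_iff h2.ne' (by positivity)]
  linear_combination (∑ S ∈ A.powersetCard (m + 1), g S) * h3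

lemma sliceAvg_eq_erase {m : ℕ} {A : Finset ι} (hm : m < A.card) (g : Finset ι → ℝ) :
    sliceAvg m A g = (∑ x ∈ A, sliceAvg m (A.erase x) g) / A.card := by
  obtain ⟨n, hn⟩ : ∃ n, A.card = n + 1 := ⟨A.card - 1, by omega⟩
  have h : ∀ x ∈ A, sliceAvg m (A.erase x) g =
      (∑ S ∈ (A.erase x).powersetCard m, g S) / (n.choose m : ℝ) := fun x hx => by
    rw [sliceAvg, Finset.card_erase_of_mem hx, hn]; rfl
  rw [Finset.sum_congr rfl h, ← Finset.sum_div, sum_powersetCard_erase hm.le, sliceAvg, hn]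
  have h1 : (0 : ℝ) < n.choose m := by exact_mod_cast Nat.choose_pos (by omega)
  have h2 : (0 : ℝ) < (n + 1).choose m := by exact_mod_cast Nat.choose_pos (by omega)
  have h3 : (n.choose m : ℝ) * ((n + 1 : ℕ) : ℝ) = (n + 1).choose m * ((n + 1 : ℕ) - m : ℝ) := by
    rw [← Nat.cast_sub (by omega)]
    exact_mod_cast Nat.choose_mul_succ_eq n m
  push_cast at h3 ⊢
  rw [div_div, div_eq_div_iff h2.ne' (by positivity)]
  linear_combination (∑ S ∈ A.powersetCard m, g S) * h3

lemma abs_sliceAvg_succ_sub_le {m : ℕ} {A : Finset ι} (hm : m < A.card) {g : Finset ι → ℝ} {c : ℝ}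
    (hg : ∀ S x, |g (insert x S) - g S| ≤ c) :
    |sliceAvg (m + 1) A g - sliceAvg m A g| ≤ c := by
  have hA : (0 : ℝ) < A.card := by exact_mod_cast (by omega : 0 < A.card)
  rw [sliceAvg_succ hm, sliceAvg_eq_erase hm, ← sub_div, ← Finset.sum_sub_distrib, abs_div,
    abs_of_pos hA, div_le_iff₀ hA]
  refine (Finset.abs_sum_le_sum_abs _ _).trans ?_
  rw [mul_comm, ← nsmul_eq_mul]
  refine Finset.sum_le_card_nsmul _ _ _ fun x hx => ?_
  exact abs_sliceAvg_sub_le (by rw [Finset.card_erase_of_mem hx]; omega) fun S => hg S x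

lemma abs_sliceAvg_add_sub_le {A : Finset ι} {g : Finset ι → ℝ} {c : ℝ}
    (hg : ∀ S x, |g (insert x S) - g S| ≤ c) (m d : ℕ) (hmd : m + d ≤ A.card) :
    |sliceAvg (m + d) A g - sliceAvg m A g| ≤ d * c := by
  induction d with
  | zero => simp
  | succ d ih =>
    have h1 := abs_sliceAvg_succ_sub_le (m := m + d) (A := A) (by omega) hg
    have h2 := abs_sub_le (sliceAvg (m + d + 1) A g) (sliceAvg (m + d) A g) (sliceAvg m A g)
    have h3 := ih (by omega)
    push_cast
    rw [← add_assoc]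
    linarith

lemma abs_sliceAvg_sub_sliceAvg_le {A : Finset ι} {g : Finset ι → ℝ} {c : ℝ}
    (hg : ∀ S x, |g (insert x S) - g S| ≤ c) {m t : ℕ} (hm : m ≤ A.card) (ht : t ≤ A.card) :
    |sliceAvg t A g - sliceAvg m A g| ≤ c * |(t : ℝ) - m| := by
  rcases le_total m t with h | h
  · obtain ⟨d, rfl⟩ := Nat.exists_eq_add_of_le h
    have := abs_sliceAvg_add_sub_le hg m d ht
    push_cast
    rw [add_sub_cancel_left, Nat.abs_cast]
    linarith
  · obtain ⟨d, rfl⟩ := Nat.exists_eq_add_of_le h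
    have := abs_sliceAvg_add_sub_le hg t d hm
    push_cast
    rw [abs_sub_comm, sub_add_cancel_left, abs_neg, Nat.abs_cast]
    linarith

/-- Fixing one element of the random set moves the average by at most `2 * c`. -/
lemma abs_sliceAvg_insert_sub_le {m : ℕ} {A : Finset ι} (hm : m < A.card) {g : Finset ι → ℝ}
    {c : ℝ} (hg : ∀ S x, |g (insert x S) - g S| ≤ c) {x : ι} (hx : x ∈ A) :
    |sliceAvg m (A.erase x) (fun S => g (insert x S)) - sliceAvg (m + 1) A g| ≤ 2 * c := by
  have hc : 0 ≤ c := (abs_nonneg _).trans (hg ∅ x)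
  obtain ⟨n, hn⟩ : ∃ n, A.card = n + 1 := ⟨A.card - 1, by omega⟩
  have hn' : (A.erase x).card = n := by rw [Finset.card_erase_of_mem hx, hn]; rfl
  have h1 : (0 : ℝ) < n.choose m := by exact_mod_cast Nat.choose_pos (by omega)
  have h2 : (0 : ℝ) < (n + 1).choose (m + 1) := by exact_mod_cast Nat.choose_pos (by omega)
  have hpas : ((n + 1).choose (m + 1) : ℝ) = n.choose m + n.choose (m + 1) := by
    exact_mod_cast Nat.choose_succ_succ n m
  set G := sliceAvg m (A.erase x) (fun S => g (insert x S)) with hG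
  have hsplit : ((n + 1).choose (m + 1) : ℝ) * sliceAvg (m + 1) A g =
      n.choose (m + 1) * sliceAvg (m + 1) (A.erase x) g + n.choose m * G := by
    have e : ∑ S ∈ A.powersetCard (m + 1), g S = ∑ S ∈ (A.erase x).powersetCard (m + 1), g S +
        ∑ S ∈ (A.erase x).powersetCard m, g (insert x S) := by
      conv_lhs => rw [← Finset.insert_erase hx]
      rw [Finset.powersetCard_succ_insert (Finset.notMem_erase x A), Finset.sum_union,
        Finset.sum_image]
      · intro S hS T hT hST
        have hxS : x ∉ S := fun h => Finset.notMem_erase x A ((Finset.mem_powersetCard.1 hS).1 h)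
        have hxT : x ∉ T := fun h => Finset.notMem_erase x A ((Finset.mem_powersetCard.1 hT).1 h)
        rw [← Finset.erase_insert hxS, ← Finset.erase_insert hxT, hST]
      · rw [Finset.disjoint_left]
        intro S hS hS'
        obtain ⟨T, _, rfl⟩ := Finset.mem_image.1 hS'
        exact Finset.notMem_erase x A
          ((Finset.mem_powersetCard.1 hS).1 (Finset.mem_insert_self x T))
    rw [hG, sliceAvg, sliceAvg, sliceAvg, hn, hn', e, mul_div_cancel₀ _ h2.ne',
      mul_div_cancel₀ _ h1.ne']
    congr 1
    rcases Nat.lt_or_ge n (m + 1) with hlt | hge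
    · rw [Finset.powersetCard_eq_empty.2 (by omega)]
      simp
    · have h3 : (0 : ℝ) < n.choose (m + 1) := by exact_mod_cast Nat.choose_pos hge
      rw [mul_div_cancel₀ _ h3.ne']
  have key : (n.choose (m + 1) : ℝ) * |sliceAvg (m + 1) (A.erase x) g - G| ≤
      n.choose (m + 1) * (2 * c) := by
    rcases Nat.lt_or_ge n (m + 1) with hlt | hge
    · simp [Nat.choose_eq_zero_of_lt hlt]
    · refine mul_le_mul_of_nonneg_left ?_ (Nat.cast_nonneg _)
      have a1 := abs_sliceAvg_succ_sub_le (m := m) (A := A.erase x) (by omega) hg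
      have a2 : |G - sliceAvg m (A.erase x) g| ≤ c :=
        abs_sliceAvg_sub_le (by omega) fun S => hg S x
      have a3 := abs_sub_le (sliceAvg (m + 1) (A.erase x) g) (sliceAvg m (A.erase x) g) G
      rw [abs_sub_comm (sliceAvg m (A.erase x) g) G] at a3
      linarith
  have hfin : ((n + 1).choose (m + 1) : ℝ) * (sliceAvg (m + 1) A g - G) =
      n.choose (m + 1) * (sliceAvg (m + 1) (A.erase x) g - G) := by
    rw [mul_sub, hsplit, hpas]; ring
  rw [abs_sub_comm]
  refine le_of_mul_le_mul_left ?_ h2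
  rw [← abs_of_pos h2, ← abs_mul, hfin, abs_mul, Nat.abs_cast, Nat.abs_cast]
  refine key.trans (mul_le_mul_of_nonneg_right ?_ (by positivity))
  rw [hpas]; linarith

/-- Exponential moments of a Lipschitz function of a uniformly random set of fixed size. -/
lemma sliceAvg_exp_le (m : ℕ) : ∀ {A : Finset ι} {g : Finset ι → ℝ} {c : ℝ}, m ≤ A.card →
    (∀ S x, |g (insert x S) - g S| ≤ c) →
    sliceAvg m A (fun S => Real.exp (g S)) ≤
      Real.exp (sliceAvg m A g + m * ((2 * c) ^ 2 / 2)) := by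
  induction m with
  | zero => intro A g c _ _; simp [sliceAvg]
  | succ m ih =>
    intro A g c hm hg
    have hA : A.Nonempty := Finset.card_pos.1 (by omega)
    have hc : (0 : ℝ) < A.card := by exact_mod_cast hA.card_pos
    have hD : ∀ x ∈ A, |sliceAvg m (A.erase x) (fun S => g (insert x S)) -
        (∑ z ∈ A, sliceAvg m (A.erase z) fun S => g (insert z S)) / A.card| ≤ 2 * c := by
      intro x hx
      rw [← sliceAvg_succ (by omega)]
      exact abs_sliceAvg_insert_sub_le (by omega) hg hx
    have h1 := avg_exp_le hA hD
    rw [sliceAvg_succ (by omega), sliceAvg_succ (by omega)]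
    have h2 : ∀ x ∈ A, sliceAvg m (A.erase x) (fun S => Real.exp (g (insert x S))) ≤
        Real.exp (m * ((2 * c) ^ 2 / 2)) *
          Real.exp (sliceAvg m (A.erase x) fun S => g (insert x S)) := by
      intro x hx
      rw [← Real.exp_add, add_comm]
      refine ih (g := fun S => g (insert x S)) (by rw [Finset.card_erase_of_mem hx]; omega)
        fun S z => ?_
      rw [Finset.insert_comm]
      exact hg _ z
    refine (div_le_div_of_nonneg_right (Finset.sum_le_sum h2) hc.le).trans ?_
    rw [← Finset.mul_sum, mul_div_assoc]
    refine (mul_le_mul_of_nonneg_left h1 (Real.exp_pos _).le).trans (le_of_eq ?_)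
    rw [← Real.exp_add]
    congr 1
    push_cast
    ring

/-- McDiarmid's inequality for a uniformly random set of fixed size. -/
lemma card_filter_lt_le {m : ℕ} {A : Finset ι} {g : Finset ι → ℝ} {c ε : ℝ} (hm : m ≤ A.card)
    (hm0 : 0 < m) (hc : 0 < c) (hg : ∀ S x, |g (insert x S) - g S| ≤ c) (hε : 0 ≤ ε) :
    (((A.powersetCard m).filter fun S => sliceAvg m A g + ε < g S).card : ℝ) ≤
      Real.exp (-(ε ^ 2 / (8 * m * c ^ 2))) * (A.card.choose m : ℝ) := by
  have hm0' : (0 : ℝ) < m := by exact_mod_cast hm0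
  have h2 : (0 : ℝ) < A.card.choose m := by exact_mod_cast Nat.choose_pos hm
  set l : ℝ := ε / (4 * m * c ^ 2) with hl
  have hl0 : 0 ≤ l := by positivity
  have h1 := sliceAvg_exp_le m (g := fun S => l * g S) (c := l * c) hm fun S x => by
    rw [← mul_sub, abs_mul, abs_of_nonneg hl0]
    exact mul_le_mul_of_nonneg_left (hg S x) hl0
  rw [sliceAvg, sliceAvg_const_mul, div_le_iff₀ h2] at h1
  have h3 : (((A.powersetCard m).filter fun S => sliceAvg m A g + ε < g S).card : ℝ) *
      Real.exp (l * (sliceAvg m A g + ε)) ≤ ∑ S ∈ A.powersetCard m, Real.exp (l * g S) := by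
    rw [← nsmul_eq_mul]
    refine (Finset.card_nsmul_le_sum _ (fun S => Real.exp (l * g S)) _ fun S hS => ?_).trans
      (Finset.sum_le_sum_of_subset_of_nonneg (Finset.filter_subset _ _)
        fun _ _ _ => (Real.exp_pos _).le)
    exact Real.exp_le_exp.2 (mul_le_mul_of_nonneg_left (Finset.mem_filter.1 hS).2.le hl0)
  refine le_of_mul_le_mul_right (h3.trans (h1.trans (le_of_eq ?_)))
    (Real.exp_pos (l * (sliceAvg m A g + ε)))
  rw [mul_right_comm, ← Real.exp_add]
  congr 2
  rw [hl]
  field_simp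
  ring

end Slice

section Bernoulli

/-- The probability that a random subset of `ι`, containing each element independently with
probability `f`, equals `T`. -/
def bernW {ι : Type*} [Fintype ι] [DecidableEq ι] (f : ℝ) (T : Finset ι) : ℝ :=
  ∏ k, if k ∈ T then f else 1 - f

variable {ι : Type*} [Fintype ι] [DecidableEq ι]

lemma bernW_eq (f : ℝ) (T : Finset ι) :
    bernW f T = f ^ T.card * (1 - f) ^ (Fintype.card ι - T.card) := by
  rw [bernW, Finset.prod_ite, Finset.prod_const, Finset.prod_const, Finset.filter_univ_mem,
    ← Finset.card_compl]
  congr 3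
  ext; simp

lemma bernW_nonneg {f : ℝ} (hf0 : 0 ≤ f) (hf1 : f ≤ 1) (T : Finset ι) : 0 ≤ bernW f T := by
  have : 0 ≤ 1 - f := by linarith
  rw [bernW_eq]; positivity

lemma sum_bernW_mul (f : ℝ) (g : Finset ι → ℝ) :
    ∑ T, bernW f T * g T = ∑ t ∈ Finset.range (Fintype.card ι + 1),
      (bernsteinPolynomial ℝ (Fintype.card ι) t).eval f * sliceAvg t Finset.univ g := by
  rw [← Finset.powerset_univ, Finset.sum_powerset, Finset.card_univ]
  refine Finset.sum_congr rfl fun t ht => ?_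
  have ht' : t ≤ Fintype.card ι := by simpa [Nat.lt_succ_iff] using ht
  have h2 : (0 : ℝ) < (Fintype.card ι).choose t := by exact_mod_cast Nat.choose_pos ht'
  have h : ∀ S ∈ Finset.univ.powersetCard t, bernW f S * g S =
      f ^ t * (1 - f) ^ (Fintype.card ι - t) * g S := fun S hS => by
    rw [bernW_eq, (Finset.mem_powersetCard.1 hS).2]
  rw [Finset.sum_congr rfl h, ← Finset.mul_sum, sliceAvg, Finset.card_univ, bernsteinPolynomial]
  simp only [Polynomial.eval_mul, Polynomial.eval_pow, Polynomial.eval_sub, Polynomial.eval_one,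
    Polynomial.eval_X, Polynomial.eval_natCast]
  field_simp

lemma sum_eval_bernsteinPolynomial (n : ℕ) (f : ℝ) :
    ∑ t ∈ Finset.range (n + 1), (bernsteinPolynomial ℝ n t).eval f = 1 := by
  rw [← Polynomial.eval_finsetSum, bernsteinPolynomial.sum, Polynomial.eval_one]

lemma eval_bernsteinPolynomial_nonneg {f : ℝ} (hf0 : 0 ≤ f) (hf1 : f ≤ 1) (n t : ℕ) :
    0 ≤ (bernsteinPolynomial ℝ n t).eval f := by
  have : 0 ≤ 1 - f := by linarith
  rw [bernsteinPolynomial]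
  simp only [Polynomial.eval_mul, Polynomial.eval_pow, Polynomial.eval_sub, Polynomial.eval_one,
    Polynomial.eval_X, Polynomial.eval_natCast]
  positivity

lemma sum_bernW (f : ℝ) : ∑ T : Finset ι, bernW f T = 1 := by
  have h := sum_bernW_mul f (fun _ : Finset ι => (1 : ℝ))
  simp only [mul_one] at h
  refine h.trans ((Finset.sum_congr rfl fun t ht => ?_).trans
    (sum_eval_bernsteinPolynomial (Fintype.card ι) f))
  rw [sliceAvg_const (by simpa [Nat.lt_succ_iff] using ht), mul_one]

lemma sum_eval_bernsteinPolynomial_mul_abs_le {n : ℕ} {f : ℝ} (hn : 0 < n * f) (hf0 : 0 < f)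
    (hf1 : f ≤ 1) :
    ∑ t ∈ Finset.range (n + 1), (bernsteinPolynomial ℝ n t).eval f * |(t : ℝ) - n * f| ≤
      Real.sqrt (n * f) := by
  have hvar := congrArg (Polynomial.eval f) (bernsteinPolynomial.variance (R := ℝ) n)
  simp only [Polynomial.eval_finsetSum, Polynomial.eval_mul, Polynomial.eval_pow,
    Polynomial.eval_sub, Polynomial.eval_one, Polynomial.eval_X, Polynomial.eval_natCast,
    nsmul_eq_mul] at hvar
  set s := Real.sqrt (n * f) with hs
  have hs0 : 0 < s := Real.sqrt_pos.2 hn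
  have hss : s ^ 2 = n * f := Real.sq_sqrt hn.le
  have h : ∀ t ∈ Finset.range (n + 1), (bernsteinPolynomial ℝ n t).eval f * |(t : ℝ) - n * f| ≤
      s / 2 * (bernsteinPolynomial ℝ n t).eval f +
        1 / (2 * s) * ((n * f - t) ^ 2 * (bernsteinPolynomial ℝ n t).eval f) := by
    intro t _
    have h0 := eval_bernsteinPolynomial_nonneg hf0.le hf1 n t
    have h1 : |(t : ℝ) - n * f| ≤ s / 2 + 1 / (2 * s) * (n * f - t) ^ 2 := by
      rw [← sq_abs, abs_sub_comm (n * f : ℝ)]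
      have := sq_nonneg (|(t : ℝ) - n * f| - s)
      rw [← sub_nonneg]
      have e : s / 2 + 1 / (2 * s) * |(t : ℝ) - n * f| ^ 2 - |(t : ℝ) - n * f| =
        (|(t : ℝ) - n * f| - s) ^ 2 / (2 * s) := by field_simp; ring
      rw [e]; positivity
    calc _ ≤ (bernsteinPolynomial ℝ n t).eval f * (s / 2 + 1 / (2 * s) * (n * f - t) ^ 2) :=
          mul_le_mul_of_nonneg_left h1 h0
      _ = _ := by ring
  refine (Finset.sum_le_sum h).trans ?_
  rw [Finset.sum_add_distrib, ← Finset.mul_sum, ← Finset.mul_sum, sum_eval_bernsteinPolynomial,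
    hvar, ← hss]
  have : 1 / (2 * s) * (s ^ 2 * (1 - f)) = s / 2 * (1 - f) := by field_simp
  rw [this]
  nlinarith

/-- A Lipschitz set function has almost the same average over sets of a fixed size and over sets
whose elements are selected independently. -/
lemma abs_sliceAvg_sub_bern_le {f c : ℝ} {m : ℕ} {g : Finset ι → ℝ} (hf0 : 0 < f) (hf1 : f ≤ 1)
    (hN : 0 < Fintype.card ι) (hm : m ≤ Fintype.card ι) (hmf : |m - Fintype.card ι * f| ≤ 1)
    (hc : 0 ≤ c) (hg : ∀ S x, |g (insert x S) - g S| ≤ c) :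
    |sliceAvg m Finset.univ g - ∑ T, bernW f T * g T| ≤
      c * (Real.sqrt (Fintype.card ι * f) + 1) := by
  have hpos : 0 < Fintype.card ι * f := mul_pos (by exact_mod_cast hN) hf0
  rw [sum_bernW_mul]
  have e : sliceAvg m Finset.univ g = ∑ t ∈ Finset.range (Fintype.card ι + 1),
      (bernsteinPolynomial ℝ (Fintype.card ι) t).eval f * sliceAvg m Finset.univ g := by
    rw [← Finset.sum_mul, sum_eval_bernsteinPolynomial, one_mul]
  rw [e, ← Finset.sum_sub_distrib]
  refine (Finset.abs_sum_le_sum_abs _ _).trans ?_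
  have h : ∀ t ∈ Finset.range (Fintype.card ι + 1),
      |(bernsteinPolynomial ℝ (Fintype.card ι) t).eval f * sliceAvg m Finset.univ g -
        (bernsteinPolynomial ℝ (Fintype.card ι) t).eval f * sliceAvg t Finset.univ g| ≤
      c * ((bernsteinPolynomial ℝ (Fintype.card ι) t).eval f * |(t : ℝ) - Fintype.card ι * f| +
        (bernsteinPolynomial ℝ (Fintype.card ι) t).eval f) := by
    intro t ht
    have h0 := eval_bernsteinPolynomial_nonneg hf0.le hf1 (Fintype.card ι) t
    have h1 := abs_sliceAvg_sub_sliceAvg_le (A := Finset.univ) hg (m := m) (t := t) (by simpa)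
      (by simpa [Nat.lt_succ_iff] using ht)
    have h2 : |(t : ℝ) - m| ≤ |(t : ℝ) - Fintype.card ι * f| + 1 := by
      have := abs_sub_le (t : ℝ) (Fintype.card ι * f) m
      rw [abs_sub_comm (Fintype.card ι * f) (m : ℝ)] at this
      linarith
    rw [← mul_sub, abs_mul, abs_of_nonneg h0, abs_sub_comm]
    calc _ ≤ (bernsteinPolynomial ℝ (Fintype.card ι) t).eval f *
          (c * (|(t : ℝ) - Fintype.card ι * f| + 1)) :=
          mul_le_mul_of_nonneg_left (h1.trans (mul_le_mul_of_nonneg_left h2 hc)) h0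
      _ = _ := by ring
  refine (Finset.sum_le_sum h).trans ?_
  rw [← Finset.mul_sum, Finset.sum_add_distrib, sum_eval_bernsteinPolynomial]
  refine mul_le_mul_of_nonneg_left ?_ hc
  linarith [sum_eval_bernsteinPolynomial_mul_abs_le hpos hf0 hf1]

/-- The difference of the indicators of two independent random sets has independent entries with
the transductive Rademacher distribution of parameter `f * (1 - f)`. -/
lemma sum_bernW_mul_bernW (f : ℝ) (H : (ι → ℝ) → ℝ) :
    ∑ T : Finset ι, ∑ U : Finset ι, bernW f T * bernW f U *
      H (fun k => (if k ∈ U then 1 else 0) - (if k ∈ T then 1 else 0)) =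
    radExp (f * (1 - f)) H := by
  let φ : Bool × Bool → Fin 3 := fun b => if b.1 = b.2 then 2 else if b.2 then 0 else 1
  let w : Bool → ℝ := fun b => if b then f else 1 - f
  have hφ : ∀ j, radW (f * (1 - f)) j = ∑ b with φ b = j, w b.1 * w b.2 := by
    intro j
    have : (Finset.univ : Finset (Bool × Bool)) =
      {(true, true), (true, false), (false, true), (false, false)} := by decide
    rw [this, Finset.sum_filter]
    fin_cases j <;> simp [φ, w, radW] <;> ring
  have h1 : radExp (f * (1 - f)) H = ∑ b : ι → Bool × Bool,
      (∏ k, w (b k).1 * w (b k).2) * H fun k => radV (φ (b k)) := by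
    rw [radExp, ← Finset.sum_fiberwise Finset.univ (fun (b : ι → Bool × Bool) k => φ (b k))]
    refine Finset.sum_congr rfl fun g _ => ?_
    simp_rw [hφ]
    rw [Finset.prod_univ_sum, Finset.sum_mul]
    refine Finset.sum_congr ?_ fun b hb => ?_
    · ext b
      simp [Fintype.mem_piFinset, funext_iff]
    · have : ∀ k, φ (b k) = g k := fun k => congrFun (Finset.mem_filter.1 hb).2 k
      simp_rw [this]
  rw [h1, ← Fintype.sum_prod_type']
  refine Fintype.sum_bijective
    (fun (p : Finset ι × Finset ι) (k : ι) => (decide (k ∈ p.1), decide (k ∈ p.2))) ?_ _ _ ?_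
  · constructor
    · rintro ⟨T, U⟩ ⟨T', U'⟩ h
      simp only [funext_iff, Prod.mk.injEq, decide_eq_decide] at h
      exact Prod.ext (Finset.ext fun k => (h k).1) (Finset.ext fun k => (h k).2)
    · intro b
      refine ⟨(Finset.univ.filter fun k => (b k).1, Finset.univ.filter fun k => (b k).2), ?_⟩
      ext k <;> simp
  · rintro ⟨T, U⟩
    simp only [bernW, ← Finset.prod_mul_distrib, w, decide_eq_true_eq]
    congr 2
    ext k
    by_cases hT : k ∈ T <;> by_cases hU : k ∈ U <;> simp [φ, hT, hU, radV]

end Bernoulli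

section SupPairing

variable {X ι : Type*} [Fintype ι]

/-- The supremum over the family `v` of the pairing with `γ`. -/
def supPairing (v : X → ι → ℝ) (γ : ι → ℝ) : ℝ := ⨆ x, ∑ k, γ k * v x k

lemma abs_sum_mul_le {M : ℝ} {u : ι → ℝ} (hu : ∀ k, |u k| ≤ M) (γ : ι → ℝ) :
    |∑ k, γ k * u k| ≤ M * ∑ k, |γ k| := by
  refine (Finset.abs_sum_le_sum_abs _ _).trans ?_
  rw [Finset.mul_sum]
  refine Finset.sum_le_sum fun k _ => ?_
  rw [abs_mul, mul_comm]
  exact mul_le_mul_of_nonneg_right (hu k) (abs_nonneg _)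

variable {v : X → ι → ℝ} {M : ℝ}

lemma bddAbove_range_pairing (hv : ∀ x k, |v x k| ≤ M) (γ : ι → ℝ) :
    BddAbove (Set.range fun x => ∑ k, γ k * v x k) := by
  refine ⟨M * ∑ k, |γ k|, ?_⟩
  rintro _ ⟨x, rfl⟩
  exact (le_abs_self _).trans (abs_sum_mul_le (hv x) γ)

lemma le_supPairing (hv : ∀ x k, |v x k| ≤ M) (γ : ι → ℝ) (x : X) :
    ∑ k, γ k * v x k ≤ supPairing v γ :=
  le_ciSup (bddAbove_range_pairing hv γ) x

variable [Nonempty X]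

lemma supPairing_le_add (hv : ∀ x k, |v x k| ≤ M) (γ γ' : ι → ℝ) :
    supPairing v γ ≤ supPairing v γ' + M * ∑ k, |γ k - γ' k| := by
  refine ciSup_le fun x => ?_
  have h1 := le_supPairing hv γ' x
  have h2 := (le_abs_self _).trans (abs_sum_mul_le (hv x) fun k => γ k - γ' k)
  simp only [sub_mul, Finset.sum_sub_distrib] at h2
  linarith

lemma abs_supPairing_sub_le (hv : ∀ x k, |v x k| ≤ M) (γ γ' : ι → ℝ) :
    |supPairing v γ - supPairing v γ'| ≤ M * ∑ k, |γ k - γ' k| := by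
  have h1 := supPairing_le_add hv γ γ'
  have h2 := supPairing_le_add hv γ' γ
  simp only [abs_sub_comm (γ' _)] at h2
  rw [abs_le]
  constructor <;> linarith

lemma supPairing_le (hv : ∀ x k, |v x k| ≤ M) (γ : ι → ℝ) :
    supPairing v γ ≤ M * ∑ k, |γ k| :=
  ciSup_le fun x => (le_abs_self _).trans (abs_sum_mul_le (hv x) γ)

lemma supPairing_add_neg_nonneg (hv : ∀ x k, |v x k| ≤ M) (γ : ι → ℝ) :
    0 ≤ supPairing v γ + supPairing v (fun k => -γ k) := by
  obtain ⟨x⟩ := ‹Nonempty X›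
  have h1 := le_supPairing hv γ x
  have h2 := le_supPairing hv (fun k => -γ k) x
  simp only [neg_mul, Finset.sum_neg_distrib] at h2
  linarith

lemma abs_supPairing_ite_insert_sub_le [DecidableEq ι] (hv : ∀ x k, |v x k| ≤ M) {c : ℝ}
    {a b : ι → ℝ} (hab : ∀ k, |a k - b k| ≤ c) (hM : 0 ≤ M) (S : Finset ι) (j : ι) :
    |supPairing v (fun k => if k ∈ insert j S then a k else b k) -
      supPairing v (fun k => if k ∈ S then a k else b k)| ≤ M * c := by
  refine (abs_supPairing_sub_le hv _ _).trans (mul_le_mul_of_nonneg_left ?_ hM)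
  rw [Finset.sum_eq_single j]
  · by_cases h : j ∈ S
    · simpa [h] using (abs_nonneg _).trans (hab j)
    · simpa [h] using hab j
  · intro k _ hk
    simp [hk]
  · simp

/-- Replacing the entry of one coordinate by a pairing with larger increments. -/
lemma supPairing_add_supPairing_flip_le [DecidableEq ι] {v' : X → ι → ℝ} {M' : ℝ}
    (hv' : ∀ x k, |v' x k| ≤ M') (k : ι)
    (hne : ∀ x j, j ≠ k → v x j = v' x j)
    (hk : ∀ x x', |v x k - v x' k| ≤ |v' x k - v' x' k|) (γ : ι → ℝ) :
    supPairing v γ + supPairing v (Function.update γ k (-γ k)) ≤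
      supPairing v' γ + supPairing v' (Function.update γ k (-γ k)) := by
  have hsplit : ∀ (w : X → ι → ℝ) (x : X),
      ∑ j, γ j * w x j = γ k * w x k + ∑ j ∈ Finset.univ.erase k, γ j * w x j := fun w x =>
    (Finset.add_sum_erase _ _ (Finset.mem_univ k)).symm
  have hsplit' : ∀ (w : X → ι → ℝ) (x : X), ∑ j, Function.update γ k (-γ k) j * w x j =
      -(γ k * w x k) + ∑ j ∈ Finset.univ.erase k, γ j * w x j := fun w x => by
    rw [← Finset.add_sum_erase _ _ (Finset.mem_univ k), Function.update_self, neg_mul]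
    congr 1
    exact Finset.sum_congr rfl fun j hj => by
      rw [Function.update_of_ne (Finset.ne_of_mem_erase hj)]
  have hrest : ∀ x, ∑ j ∈ Finset.univ.erase k, γ j * v x j =
      ∑ j ∈ Finset.univ.erase k, γ j * v' x j := fun x =>
    Finset.sum_congr rfl fun j hj => by rw [hne x j (Finset.ne_of_mem_erase hj)]
  have main : ∀ x x', (∑ j, γ j * v x j) + ∑ j, Function.update γ k (-γ k) j * v x' j ≤
      supPairing v' γ + supPairing v' (Function.update γ k (-γ k)) := by
    intro x x'
    have a1 := le_supPairing hv' γ x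
    have a2 := le_supPairing hv' γ x'
    have b1 := le_supPairing hv' (Function.update γ k (-γ k)) x
    have b2 := le_supPairing hv' (Function.update γ k (-γ k)) x'
    rw [hsplit] at a1 a2
    rw [hsplit'] at b1 b2
    rw [hsplit, hsplit', hrest, hrest]
    have h : γ k * v x k - γ k * v x' k ≤ |γ k * v' x k - γ k * v' x' k| := by
      rw [← mul_sub, ← mul_sub, abs_mul]
      refine (le_abs_self _).trans ?_
      rw [abs_mul]
      exact mul_le_mul_of_nonneg_left (hk x x') (abs_nonneg _)
    rcases abs_cases (γ k * v' x k - γ k * v' x' k) with ⟨h', _⟩ | ⟨h', _⟩ <;>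
      rw [h'] at h <;> linarith
  have h1 : supPairing v γ ≤ supPairing v' γ + supPairing v' (Function.update γ k (-γ k)) -
      supPairing v (Function.update γ k (-γ k)) := by
    refine ciSup_le fun x => ?_
    have : supPairing v (Function.update γ k (-γ k)) ≤ supPairing v' γ +
        supPairing v' (Function.update γ k (-γ k)) - ∑ j, γ j * v x j :=
      ciSup_le fun x' => by linarith [main x x']
    linarith
  linarith

end SupPairing

section RadExp

variable {ι : Type*} [Fintype ι] [DecidableEq ι]

lemma radW_nonneg {p : ℝ} (hp0 : 0 ≤ p) (hp1 : p ≤ 1 / 2) (j : Fin 3) : 0 ≤ radW p j := by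
  fin_cases j <;> simp [radW] <;> linarith

lemma radExp_mono {p : ℝ} (hp0 : 0 ≤ p) (hp1 : p ≤ 1 / 2) {h h' : (ι → ℝ) → ℝ}
    (hh : ∀ γ, h γ ≤ h' γ) : radExp p h ≤ radExp p h' :=
  Finset.sum_le_sum fun _ _ => mul_le_mul_of_nonneg_left (hh _)
    (Finset.prod_nonneg fun _ _ => radW_nonneg hp0 hp1 _)

lemma radExp_add (p : ℝ) (h h' : (ι → ℝ) → ℝ) :
    radExp p (fun γ => h γ + h' γ) = radExp p h + radExp p h' := by
  simp only [radExp, mul_add, Finset.sum_add_distrib]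

lemma radExp_const_mul (p c : ℝ) (h : (ι → ℝ) → ℝ) :
    radExp p (fun γ => c * h γ) = c * radExp p h := by
  simp only [radExp, Finset.mul_sum]
  exact Finset.sum_congr rfl fun _ _ => by ring

/-- The distribution of `γ` is invariant under a sign change of one coordinate. -/
lemma radExp_flip (p : ℝ) (h : (ι → ℝ) → ℝ) (k : ι) :
    radExp p (fun γ => h (Function.update γ k (-γ k))) = radExp p h := by
  let σ : Fin 3 → Fin 3 := ![1, 0, 2]
  have hσ : ∀ j, σ (σ j) = j := by decide
  have hV : ∀ j, radV (σ j) = -radV j := by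
    intro j; fin_cases j <;> simp [σ, radV]
  have hW : ∀ j, radW p (σ j) = radW p j := by
    intro j; fin_cases j <;> simp [σ, radW]
  have hinv : Function.Involutive fun g : ι → Fin 3 => Function.update g k (σ (g k)) := by
    intro g
    simp [hσ]
  refine Fintype.sum_bijective _ hinv.bijective _ _ fun g => ?_
  congr 1
  · refine Finset.prod_congr rfl fun j _ => ?_
    by_cases hj : j = k
    · subst hj; simp [hW]
    · simp [hj]
  · refine congrArg h (funext fun j => ?_)
    by_cases hj : j = k
    · subst hj; simp [hV]
    · simp [hj]

/-- The contraction principle. -/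
lemma radExp_supPairing_le {X : Type*} [Nonempty X] {p : ℝ} (hp0 : 0 ≤ p) (hp1 : p ≤ 1 / 2)
    {v w : X → ι → ℝ} {M M' : ℝ} (hv : ∀ x k, |v x k| ≤ M) (hw : ∀ x k, |w x k| ≤ M')
    (hvw : ∀ x x' k, |v x k - v x' k| ≤ |w x k - w x' k|) :
    radExp p (supPairing v) ≤ radExp p (supPairing w) := by
  suffices h : ∀ A : Finset ι, radExp p (supPairing v) ≤
      radExp p (supPairing fun x k => if k ∈ A then w x k else v x k) by
    simpa using h Finset.univ
  intro A
  induction A using Finset.induction_on with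
  | empty => simp
  | insert k A hk ih =>
    refine ih.trans ?_
    have hb : ∀ x j, |(if j ∈ insert k A then w x j else v x j)| ≤ max M M' := by
      intro x j
      split_ifs
      · exact (hw x j).trans (le_max_right _ _)
      · exact (hv x j).trans (le_max_left _ _)
    have h := radExp_mono hp0 hp1 (supPairing_add_supPairing_flip_le
      (v := fun x j => if j ∈ A then w x j else v x j) hb k
      (fun x j hj => by simp [hj]) (fun x x' => by simpa [hk] using hvw x x' k))
    rw [radExp_add, radExp_add, radExp_flip, radExp_flip] at h
    linarith

end RadExp

section Transductive

variable {X : Type*} [Nonempty X] {N m : ℕ} {v : X → Fin N → ℝ} {B f : ℝ}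

lemma sliceAvg_indicator (hm0 : 0 < m) (hm : m ≤ N) (k : Fin N) :
    sliceAvg m Finset.univ (fun U => if k ∈ U then (1 : ℝ) else 0) = m / N := by
  obtain ⟨m, rfl⟩ : ∃ m', m = m' + 1 := ⟨m - 1, by omega⟩
  obtain ⟨N, rfl⟩ : ∃ N', N = N' + 1 := ⟨N - 1, by omega⟩
  have h := Finset.card_filter_powersetCard_subset {k} (Finset.univ : Finset (Fin (N + 1)))
    (m + 1) (Finset.subset_univ _) (by simp)
  simp only [Finset.singleton_subset_iff, Finset.card_univ, Fintype.card_fin,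
    Finset.card_singleton, Nat.add_sub_cancel] at h
  rw [sliceAvg, ← Finset.sum_filter, Finset.sum_const, h, Finset.card_univ, Fintype.card_fin,
    nsmul_eq_mul, mul_one]
  have h2 : (0 : ℝ) < (N + 1).choose (m + 1) := by exact_mod_cast Nat.choose_pos hm
  rw [div_eq_div_iff h2.ne' (by positivity), mul_comm, mul_comm ((m + 1 : ℕ) : ℝ)]
  exact_mod_cast Nat.add_one_mul_choose_eq N m

/-- The worst gap over the family `v` between the average on the complement of `S` and the
average on `S`, where `S` has `m` elements. -/
def supGap (m : ℕ) (v : X → Fin N → ℝ) (S : Finset (Fin N)) : ℝ :=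
  supPairing v fun k => if k ∈ S then -(1 / (m : ℝ)) else 1 / ((N : ℝ) - m)

/-- The supremum of the pairing with a difference of two indicators. -/
def supDiff (v : X → Fin N → ℝ) (S U : Finset (Fin N)) : ℝ :=
  supPairing v fun k => (if k ∈ U then 1 else 0) - (if k ∈ S then 1 else 0)

lemma supGap_le (hv : ∀ x k, |v x k| ≤ B) (hm0 : 0 < m) (hm : m < N) (S : Finset (Fin N)) :
    supGap m v S ≤ N / (m * ((N : ℝ) - m)) * sliceAvg m Finset.univ (supDiff v S) := by
  have hm0' : (0 : ℝ) < m := by exact_mod_cast hm0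
  have hmN : (m : ℝ) < N := by exact_mod_cast hm
  have hu : (0 : ℝ) < (N : ℝ) - m := by linarith
  have hN : (0 : ℝ) < N := by linarith
  refine ciSup_le fun x => ?_
  have h1 : sliceAvg m Finset.univ (fun U : Finset (Fin N) =>
      ∑ k, ((if k ∈ U then (1 : ℝ) else 0) - (if k ∈ S then 1 else 0)) * v x k) =
      ∑ k, ((m : ℝ) / N - (if k ∈ S then 1 else 0)) * v x k := by
    have h2 : ∀ k, (m : ℝ) / N - (if k ∈ S then 1 else 0) = sliceAvg m Finset.univ
        (fun U : Finset (Fin N) => (if k ∈ U then (1 : ℝ) else 0) +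
          -(if k ∈ S then (1 : ℝ) else 0)) := fun k => by
      rw [sliceAvg_add, sliceAvg_indicator hm0 hm.le, sliceAvg_const (by simpa using hm.le)]
      ring
    simp_rw [h2]
    simp only [sliceAvg]
    rw [Finset.sum_comm, Finset.sum_div]
    refine Finset.sum_congr rfl fun k _ => ?_
    rw [← Finset.sum_mul, div_mul_eq_mul_div]
    simp only [sub_eq_add_neg]
  have h3 : ∑ k, (if k ∈ S then -(1 / (m : ℝ)) else 1 / ((N : ℝ) - m)) * v x k =
      N / (m * ((N : ℝ) - m)) * sliceAvg m Finset.univ (fun U : Finset (Fin N) =>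
      ∑ k, ((if k ∈ U then (1 : ℝ) else 0) - (if k ∈ S then 1 else 0)) * v x k) := by
    rw [h1, Finset.mul_sum]
    refine Finset.sum_congr rfl fun k _ => ?_
    rw [← mul_assoc]
    congr 1
    split_ifs <;> field_simp <;> ring
  rw [h3]
  refine mul_le_mul_of_nonneg_left (sliceAvg_mono fun U _ => ?_) (by positivity)
  exact le_supPairing hv _ x

lemma abs_supDiff_insert_right_sub_le (hv : ∀ x k, |v x k| ≤ B) (hB : 0 ≤ B)
    (S U : Finset (Fin N)) (j : Fin N) : |supDiff v S (insert j U) - supDiff v S U| ≤ B := by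
  have h := abs_supPairing_ite_insert_sub_le hv (c := 1)
    (a := fun k => 1 - (if k ∈ S then 1 else 0)) (b := fun k => 0 - (if k ∈ S then 1 else 0))
    (fun k => by simp) hB U j
  simpa only [supDiff, ite_sub, mul_one] using h

lemma abs_supDiff_insert_left_sub_le (hv : ∀ x k, |v x k| ≤ B) (hB : 0 ≤ B)
    (S U : Finset (Fin N)) (j : Fin N) : |supDiff v (insert j S) U - supDiff v S U| ≤ B := by
  have h := abs_supPairing_ite_insert_sub_le hv (c := 1)
    (a := fun k => (if k ∈ U then 1 else 0) - 1) (b := fun k => (if k ∈ U then 1 else 0) - 0)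
    (fun k => by simp) hB S j
  have e : ∀ S' : Finset (Fin N), supDiff v S' U = supPairing v fun k =>
      if k ∈ S' then (if k ∈ U then (1 : ℝ) else 0) - 1 else (if k ∈ U then 1 else 0) - 0 := by
    intro S'
    refine congrArg (supPairing v) (funext fun k => ?_)
    split_ifs <;> simp
  rw [e, e]
  simpa only [mul_one] using h

lemma sliceAvg_sliceAvg_supDiff_le (hv : ∀ x k, |v x k| ≤ B) (hB : 0 ≤ B) (hN : 0 < N)
    (hf0 : 0 < f) (hf1 : f ≤ 1) (hm : m ≤ N) (hmf : |m - N * f| ≤ 1) :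
    sliceAvg m Finset.univ (fun S => sliceAvg m Finset.univ (supDiff v S)) ≤
      radExp (f * (1 - f)) (supPairing v) + 2 * (B * (Real.sqrt (N * f) + 1)) := by
  have hcard : Fintype.card (Fin N) = N := Fintype.card_fin N
  have h1 : ∀ S, sliceAvg m Finset.univ (supDiff v S) ≤
      ∑ U, bernW f U * supDiff v S U + B * (Real.sqrt (N * f) + 1) := fun S => by
    have := abs_sliceAvg_sub_bern_le (m := m) hf0 hf1 (by rwa [hcard]) (by rwa [hcard])
      (by rwa [hcard]) hB (abs_supDiff_insert_right_sub_le hv hB S)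
    rw [hcard] at this
    linarith [(abs_le.1 this).2]
  have h2 : |sliceAvg m Finset.univ (fun S => ∑ U, bernW f U * supDiff v S U) -
      ∑ T, bernW f T * ∑ U, bernW f U * supDiff v T U| ≤ B * (Real.sqrt (N * f) + 1) := by
    have := abs_sliceAvg_sub_bern_le (m := m) (c := B)
      (g := fun S => ∑ U, bernW f U * supDiff v S U) hf0 hf1 (by rwa [hcard]) (by rwa [hcard])
      (by rwa [hcard]) hB fun S j => by
        rw [← Finset.sum_sub_distrib]
        calc _ ≤ ∑ U : Finset (Fin N), bernW f U * B := by
              refine (Finset.abs_sum_le_sum_abs _ _).trans (Finset.sum_le_sum fun U _ => ?_)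
              rw [← mul_sub, abs_mul, abs_of_nonneg (bernW_nonneg hf0.le hf1 U)]
              exact mul_le_mul_of_nonneg_left (abs_supDiff_insert_left_sub_le hv hB S U j)
                (bernW_nonneg hf0.le hf1 U)
          _ = B := by rw [← Finset.sum_mul, sum_bernW, one_mul]
    rwa [hcard] at this
  have h3 : ∑ T, bernW f T * ∑ U, bernW f U * supDiff v T U =
      radExp (f * (1 - f)) (supPairing v) := by
    rw [← sum_bernW_mul_bernW]
    refine Finset.sum_congr rfl fun T _ => ?_
    rw [Finset.mul_sum]
    exact Finset.sum_congr rfl fun U _ => by rw [← mul_assoc, supDiff]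
  have h4 : sliceAvg m Finset.univ (fun S => sliceAvg m Finset.univ (supDiff v S)) ≤ _ :=
    sliceAvg_mono fun S _ => h1 S
  rw [sliceAvg_add, sliceAvg_const (by simpa using hm)] at h4
  rw [h3] at h2
  linarith [(abs_le.1 h2).2]

lemma radExp_supPairing_nonneg (hv : ∀ x k, |v x k| ≤ B) (hf0 : 0 ≤ f) (hf1 : f ≤ 1) :
    0 ≤ radExp (f * (1 - f)) (supPairing v) := by
  have h : radExp (f * (1 - f)) (supPairing v) =
      ∑ T : Finset (Fin N), ∑ U : Finset (Fin N), bernW f T * bernW f U * supDiff v T U :=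
    (sum_bernW_mul_bernW _ _).symm
  have h' : radExp (f * (1 - f)) (supPairing v) =
      ∑ T : Finset (Fin N), ∑ U : Finset (Fin N), bernW f T * bernW f U * supDiff v U T := by
    rw [h, Finset.sum_comm]
    exact Finset.sum_congr rfl fun T _ => Finset.sum_congr rfl fun U _ => by ring
  have h2 : 0 ≤ radExp (f * (1 - f)) (supPairing v) + radExp (f * (1 - f)) (supPairing v) := by
    nth_rewrite 1 [h]
    rw [h']
    simp only [← Finset.sum_add_distrib, ← mul_add]
    refine Finset.sum_nonneg fun T _ => Finset.sum_nonneg fun U _ => mul_nonneg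
      (mul_nonneg (bernW_nonneg hf0 hf1 T) (bernW_nonneg hf0 hf1 U)) ?_
    have := supPairing_add_neg_nonneg hv
      (fun k => (if k ∈ U then (1 : ℝ) else 0) - (if k ∈ T then 1 else 0))
    simp only [neg_sub] at this
    exact this
  linarith

lemma radExp_supPairing_le_card (hv : ∀ x k, |v x k| ≤ B) (hB : 0 ≤ B) (hf0 : 0 ≤ f)
    (hf1 : f ≤ 1) : radExp (f * (1 - f)) (supPairing v) ≤ B * N := by
  rw [← sum_bernW_mul_bernW]
  calc _ ≤ ∑ T : Finset (Fin N), ∑ U : Finset (Fin N), bernW f T * bernW f U * (B * N) := by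
        refine Finset.sum_le_sum fun T _ => Finset.sum_le_sum fun U _ =>
          mul_le_mul_of_nonneg_left ?_
            (mul_nonneg (bernW_nonneg hf0 hf1 T) (bernW_nonneg hf0 hf1 U))
        refine (supPairing_le hv _).trans (mul_le_mul_of_nonneg_left ?_ hB)
        refine (Finset.sum_le_card_nsmul _ _ 1 fun k _ => ?_).trans (by simp)
        split_ifs <;> simp
    _ = B * N := by
        simp only [← Finset.sum_mul, ← Finset.mul_sum, sum_bernW, mul_one, one_mul]

lemma sliceAvg_supGap_le (hv : ∀ x k, |v x k| ≤ B) (hB : 0 ≤ B) (hf0 : 0 < f) (hf1 : f ≤ 1 / 2)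
    (hNf : 4 ≤ N * f) (hm : m < N) (hmf : N * f ≤ m) (hmf' : m ≤ N * f + 1) :
    sliceAvg m Finset.univ (supGap m v) ≤
      radExp (f * (1 - f)) (supPairing v) / (N * (f * (1 - f))) +
        16 * B / Real.sqrt (N * f) := by
  have hm0' : (0 : ℝ) < m := by linarith
  have hm0 : 0 < m := by exact_mod_cast hm0'
  have hmN : (m : ℝ) < N := by exact_mod_cast hm
  have hN : (0 : ℝ) < N := by linarith
  have hu : (0 : ℝ) < (N : ℝ) - m := by linarith
  have hN8 : (8 : ℝ) ≤ N := by nlinarith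
  set s := Real.sqrt (N * f) with hs
  have hss : s ^ 2 = N * f := Real.sq_sqrt (by linarith)
  have hs2 : 2 ≤ s := Real.le_sqrt_of_sq_le (by linarith)
  set W := radExp (f * (1 - f)) (supPairing v) with hW
  have hW0 : 0 ≤ W := radExp_supPairing_nonneg hv hf0.le (by linarith)
  have hWN : W ≤ B * N := radExp_supPairing_le_card hv hB hf0.le (by linarith)
  have h1 : sliceAvg m Finset.univ (supGap m v) ≤ N / (m * ((N : ℝ) - m)) *
      (W + 2 * (B * (s + 1))) := by
    refine (sliceAvg_mono fun S _ => supGap_le hv hm0 hm S).trans ?_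
    rw [sliceAvg_const_mul]
    refine mul_le_mul_of_nonneg_left ?_ (by positivity)
    exact sliceAvg_sliceAvg_supDiff_le hv hB (by omega) hf0 (by linarith) hm.le
      (abs_le.2 ⟨by linarith, by linarith⟩)
  set q := N * (1 - f) - 1 with hq
  have hqN : N / 4 ≤ q := by nlinarith
  have hq0 : 0 < q := by linarith
  have h2 : N / (m * ((N : ℝ) - m)) ≤ 1 / (f * q) := by
    rw [div_le_div_iff₀ (by positivity) (by positivity), one_mul]
    have : q ≤ N - m := by rw [hq]; linarith
    calc (N : ℝ) * (f * q) = N * f * q := by ring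
      _ ≤ m * (N - m) := mul_le_mul hmf this hq0.le hm0'.le
  have hf' : 0 < 1 - f := by linarith
  have h3 : 1 / (f * q) * W ≤ W / (N * (f * (1 - f))) + 8 * B / s ^ 2 := by
    have e : 1 / (f * q) * W = W / (N * (f * (1 - f))) + W / (f * q * (N * (1 - f))) := by
      rw [hq] at hq0 ⊢
      field_simp
      ring
    rw [e]
    refine add_le_add_right ?_ _
    rw [hss, div_le_div_iff₀ (by positivity) (by positivity)]
    have a1 : (N : ℝ) / 4 * (N / 2) ≤ q * (N * (1 - f)) :=
      mul_le_mul hqN (by nlinarith) (by positivity) hq0.le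
    calc W * (N * f) ≤ B * N * (N * f) := mul_le_mul_of_nonneg_right hWN (by positivity)
      _ = 8 * B * f * (N / 4 * (N / 2)) := by ring
      _ ≤ 8 * B * f * (q * (N * (1 - f))) := mul_le_mul_of_nonneg_left a1 (by positivity)
      _ = _ := by ring
  have h4 : 1 / (f * q) ≤ 4 / s ^ 2 := by
    rw [hss, div_le_div_iff₀ (by positivity) (by positivity)]
    nlinarith
  have h5 : 1 / (f * q) * (2 * (B * (s + 1))) ≤ 4 / s ^ 2 * (2 * (B * (s + 1))) :=
    mul_le_mul_of_nonneg_right h4 (by positivity)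
  have h6 : 8 * B / s ^ 2 + 4 / s ^ 2 * (2 * (B * (s + 1))) ≤ 16 * B / s := by
    have e : 8 * B / s ^ 2 + 4 / s ^ 2 * (2 * (B * (s + 1))) = 8 * B * (s + 2) / s ^ 2 := by
      field_simp; ring
    rw [e, div_le_div_iff₀ (by positivity) (by positivity)]
    nlinarith [mul_nonneg (mul_nonneg hB (by linarith : 0 ≤ s)) (by linarith : 0 ≤ s - 2)]
  calc _ ≤ _ := h1
    _ ≤ 1 / (f * q) * (W + 2 * (B * (s + 1))) := mul_le_mul_of_nonneg_right h2 (by positivity)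
    _ ≤ _ := by rw [mul_add]; linarith

/-- With probability at least `1 - δ`, the gap between test and training averages is bounded
uniformly over `v` by the transductive Rademacher complexity plus a deviation term. -/
lemma card_filter_supGap_le (hv : ∀ x k, |v x k| ≤ B) (hB : 0 < B) (hf0 : 0 < f) (hf1 : f ≤ 1 / 2)
    (hNf : 4 ≤ N * f) (hm : m < N) (hmf : N * f ≤ m) (hmf' : m ≤ N * f + 1) {δ : ℝ} (hδ0 : 0 < δ)
    (hδ1 : δ < 1) :
    (1 - δ) * ((Finset.univ : Finset (Fin N)).powersetCard m).card ≤
      ((((Finset.univ : Finset (Fin N)).powersetCard m).filter fun S => supGap m v S ≤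
        radExp (f * (1 - f)) (supPairing v) / (N * (f * (1 - f))) +
          16 * B * (1 + Real.sqrt (Real.log (1 / δ))) / Real.sqrt (N * f)).card : ℝ) := by
  have hm0' : (0 : ℝ) < m := by linarith
  have hm0 : 0 < m := by exact_mod_cast hm0'
  have hmN : (m : ℝ) < N := by exact_mod_cast hm
  have hN : (0 : ℝ) < N := by linarith
  have hu : (0 : ℝ) < (N : ℝ) - m := by linarith
  have hN8 : (8 : ℝ) ≤ N := by nlinarith
  have hE := sliceAvg_supGap_le hv hB.le hf0 hf1 hNf hm hmf hmf'
  set s := Real.sqrt (N * f) with hs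
  have hss : s ^ 2 = N * f := Real.sq_sqrt (by linarith)
  have hs2 : 2 ≤ s := Real.le_sqrt_of_sq_le (by linarith)
  set L := Real.log (1 / δ) with hL
  have hL0 : 0 ≤ L := Real.log_nonneg (by rw [le_div_iff₀ hδ0]; linarith)
  set c := B * (N / (m * ((N : ℝ) - m))) with hc
  have hc0 : 0 < c := by positivity
  set ε := c * Real.sqrt (8 * m * L) with hε
  have hLip : ∀ S x, |supGap m v (insert x S) - supGap m v S| ≤ c := by
    refine abs_supPairing_ite_insert_sub_le hv (fun k => le_of_eq ?_) hB.le
    have e : -(1 / (m : ℝ)) - 1 / ((N : ℝ) - m) = -(N / (m * ((N : ℝ) - m))) := by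
      field_simp; ring
    rw [e, abs_neg, abs_of_pos (by positivity)]
  have hconc := card_filter_lt_le (A := (Finset.univ : Finset (Fin N))) (by simpa using hm.le) hm0
    hc0 hLip (ε := ε) (by positivity)
  have hexp : Real.exp (-(ε ^ 2 / (8 * m * c ^ 2))) = δ := by
    have : ε ^ 2 / (8 * m * c ^ 2) = L := by
      rw [hε, mul_pow, Real.sq_sqrt (by positivity)]
      field_simp
    rw [this, hL, one_div, Real.log_inv, neg_neg, Real.exp_log hδ0]
  rw [hexp, ← Finset.card_powersetCard] at hconc
  have hεs : ε ≤ 16 * B * Real.sqrt L / s := by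
    have a1 : Real.sqrt (8 * m * L) ≤ 3 * Real.sqrt m * Real.sqrt L := by
      rw [Real.sqrt_le_left (by positivity), mul_pow, mul_pow, Real.sq_sqrt hm0'.le,
        Real.sq_sqrt hL0]
      nlinarith [mul_nonneg hm0'.le hL0]
    have a2 : N / (m * ((N : ℝ) - m)) ≤ 4 / m := by
      have : (N : ℝ) ≤ 4 * (N - m) := by nlinarith
      rw [div_le_div_iff₀ (by positivity) hm0']
      nlinarith
    have a3 : s ≤ Real.sqrt m := Real.sqrt_le_sqrt hmf
    have hsm : 0 < Real.sqrt m := Real.sqrt_pos.2 hm0'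
    have hsq : Real.sqrt m ^ 2 = m := Real.sq_sqrt hm0'.le
    calc ε ≤ B * (4 / m) * (3 * Real.sqrt m * Real.sqrt L) := by
          rw [hε, hc]; gcongr
      _ = 12 * B * Real.sqrt L / Real.sqrt m := by
          nth_rewrite 1 [← hsq]
          field_simp
          ring
      _ ≤ 12 * B * Real.sqrt L / s := by gcongr
      _ ≤ 16 * B * Real.sqrt L / s := by gcongr; norm_num
  have hadd := Finset.card_filter_add_card_filter_not
    (s := (Finset.univ : Finset (Fin N)).powersetCard m)
    (fun S => sliceAvg m Finset.univ (supGap m v) + ε < supGap m v S)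
  have hadd' : ((((Finset.univ : Finset (Fin N)).powersetCard m).filter
      fun S => sliceAvg m Finset.univ (supGap m v) + ε < supGap m v S).card : ℝ) +
      (((Finset.univ : Finset (Fin N)).powersetCard m).filter
      fun S => ¬ sliceAvg m Finset.univ (supGap m v) + ε < supGap m v S).card =
      ((Finset.univ : Finset (Fin N)).powersetCard m).card := by exact_mod_cast hadd
  have hmono : ((((Finset.univ : Finset (Fin N)).powersetCard m).filter
      fun S => ¬ sliceAvg m Finset.univ (supGap m v) + ε < supGap m v S).card : ℝ) ≤
      ((((Finset.univ : Finset (Fin N)).powersetCard m).filter fun S => supGap m v S ≤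
        radExp (f * (1 - f)) (supPairing v) / (N * (f * (1 - f))) +
          16 * B * (1 + Real.sqrt L) / s).card : ℝ) := by
    refine Nat.cast_le.2 (Finset.card_le_card fun S hS => ?_)
    simp only [Finset.mem_filter, not_lt] at hS ⊢
    refine ⟨hS.1, ?_⟩
    have : 16 * B * (1 + Real.sqrt L) / s = 16 * B / s + 16 * B * Real.sqrt L / s := by ring
    linarith [hS.2]
  linarith

end Transductive

/-- transductive generalization bound for the class
`ℱ = {K̃β : ‖β‖_∞ ≤ C}`: there is a universal constant `C₁ > 0` such that with
probability at least `1 - δ` over a uniformly random training set `S` of size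
`m = ⌈Nf⌉`, for all `F ∈ ℱ` the test error is bounded by the training error plus
`R/(ρ f(1-f)) + C₁ B (1 + √ln(1/δ))/((1-f)√(Nf))`, where `R` is the transductive
Rademacher complexity of `ℱ` with parameter `p = f(1-f)`. -/
theorem stmt_10 : ∃ C₁ : ℝ, 0 < C₁ ∧
    ∀ (N : ℕ), 2 ≤ N →
    ∀ y : Fin N → ℝ, (∀ k, y k = 1 ∨ y k = -1) →
    ∀ f : ℝ, 0 < f → f ≤ 1 / 2 →
    ∀ m : ℕ, m = ⌈(N : ℝ) * f⌉₊ → m < N →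
    ∀ Ktil : Matrix (Fin N) (Fin N) ℝ, Ktil.PosSemidef →
    ∀ C : ℝ, 0 < C →
    ∀ ρ B : ℝ, 0 < ρ → 0 < B →
    ∀ ℓ : ℝ → ℝ → ℝ,
      (∀ a t, (a = 1 ∨ a = -1) → ℓ a t ∈ Set.Icc 0 B) →
      (∀ a t t', (a = 1 ∨ a = -1) → |ℓ a t - ℓ a t'| ≤ (1 / ρ) * |t - t'|) →
    ∀ δ : ℝ, 0 < δ → δ < 1 →
    (((Finset.powersetCard m (Finset.univ : Finset (Fin N))).filter
        (fun S : Finset (Fin N) =>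
          ∀ β : Fin N → ℝ, (∀ k, |β k| ≤ C) →
            (1 / ((N : ℝ) - m)) * ∑ k ∈ Sᶜ, ℓ (y k) ((Ktil *ᵥ β) k) ≤
              (1 / (m : ℝ)) * ∑ k ∈ S, ℓ (y k) ((Ktil *ᵥ β) k) +
              ((1 / (N : ℝ)) * radExp (f * (1 - f)) (fun γ =>
                  sSup {x : ℝ | ∃ β' : Fin N → ℝ, (∀ k, |β' k| ≤ C) ∧
                    x = β' ⬝ᵥ (Ktil *ᵥ γ)})) / (ρ * (f * (1 - f))) +
              C₁ * B * (1 + Real.sqrt (Real.log (1 / δ))) /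
                ((1 - f) * Real.sqrt ((N : ℝ) * f)))).card : ℝ)
      ≥ (1 - δ) * ((Finset.powersetCard m (Finset.univ : Finset (Fin N))).card : ℝ) := by
  refine ⟨16, by norm_num, ?_⟩
  intro N hN2 y hy f hf0 hf1 m hm hmN K hK C hC ρ B hρ hB ℓ hℓ hLip δ hδ0 hδ1
  let X := {β : Fin N → ℝ // ∀ k, |β k| ≤ C}
  have : Nonempty X := ⟨⟨0, fun k => by simpa using hC.le⟩⟩
  let F : X → Fin N → ℝ := fun x => K *ᵥ x.1
  let v : X → Fin N → ℝ := fun x k => ℓ (y k) (F x k)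
  have hNpos : (0 : ℝ) < N := by exact_mod_cast (by omega : 0 < N)
  have hmN' : (m : ℝ) < N := by exact_mod_cast hmN
  have hNf : 0 < (N : ℝ) * f := by positivity
  have hmf : (N : ℝ) * f ≤ m := hm ▸ Nat.le_ceil _
  have hmf' : (m : ℝ) ≤ N * f + 1 := hm ▸ (Nat.ceil_lt_add_one hNf.le).le
  have hm0 : (0 : ℝ) < m := by linarith
  have h1f : 0 < 1 - f := by linarith
  have hp0 : 0 < f * (1 - f) := by positivity
  have hp1 : f * (1 - f) ≤ 1 / 2 := by nlinarith
  have hv : ∀ x k, |v x k| ≤ B := fun x k => by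
    obtain ⟨h0, h1⟩ := hℓ (y k) (F x k) (hy k)
    rwa [abs_of_nonneg h0]
  have hF : ∀ x k, |F x k| ≤ ∑ i, ∑ j, |K i j| * C := fun x k => by
    refine (Finset.abs_sum_le_sum_abs (fun j => K k j * x.1 j) Finset.univ).trans ?_
    have hrow : ∑ j, |K k j| * C ≤ ∑ i, ∑ j, |K i j| * C :=
      Finset.single_le_sum (f := fun i => ∑ j, |K i j| * C)
        (fun i _ => Finset.sum_nonneg fun j _ => mul_nonneg (abs_nonneg _) hC.le)
        (Finset.mem_univ k)
    refine le_trans (Finset.sum_le_sum fun j _ => ?_) hrow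
    rw [abs_mul]
    exact mul_le_mul_of_nonneg_left (x.2 j) (abs_nonneg _)
  have hsup : (fun γ => sSup {x : ℝ | ∃ β' : Fin N → ℝ, (∀ k, |β' k| ≤ C) ∧
      x = β' ⬝ᵥ (K *ᵥ γ)}) = supPairing F := by
    funext γ
    refine congrArg sSup (Set.ext fun x => ?_)
    have hsymm : ∀ β : Fin N → ℝ, β ⬝ᵥ (K *ᵥ γ) = ∑ k, γ k * (K *ᵥ β) k := fun β => by
      have hT : Kᵀ = K := by simpa [Matrix.conjTranspose_eq_transpose_of_trivial] using hK.1.eq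
      rw [Matrix.dotProduct_mulVec, ← Matrix.mulVec_transpose, hT, dotProduct_comm]
      rfl
    constructor
    · rintro ⟨β, hβ, rfl⟩
      exact ⟨⟨β, hβ⟩, (hsymm β).symm⟩
    · rintro ⟨β, rfl⟩
      exact ⟨β.1, β.2, (hsymm β.1).symm⟩
  rw [hsup]
  have hR0 : 0 ≤ radExp (f * (1 - f)) (supPairing F) := by
    have h0 : radExp (ι := Fin N) (f * (1 - f)) (fun _ => 0) = 0 := by simp [radExp]
    rw [← h0]
    refine radExp_mono hp0.le hp1 fun γ => ?_
    have := le_supPairing hF γ ⟨0, fun k => by simpa using hC.le⟩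
    simpa [F] using this
  have hcontr : radExp (f * (1 - f)) (supPairing v) ≤
      1 / ρ * radExp (f * (1 - f)) (supPairing F) := by
    have hw : ∀ (x : X) k, |1 / ρ * F x k| ≤ 1 / ρ * ∑ i, ∑ j, |K i j| * C := fun x k => by
      rw [abs_mul, abs_of_pos (by positivity : 0 < 1 / ρ)]
      exact mul_le_mul_of_nonneg_left (hF x k) (by positivity)
    have h := radExp_supPairing_le hp0.le hp1 hv hw fun x x' k => by
      rw [← mul_sub, abs_mul, abs_of_pos (by positivity : 0 < 1 / ρ)]
      exact hLip (y k) (F x k) (F x' k) (hy k)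
    refine h.trans (le_of_eq ?_)
    rw [← radExp_const_mul]
    refine congrArg (radExp (f * (1 - f))) (funext fun γ => ?_)
    rw [supPairing, supPairing, Real.mul_iSup_of_nonneg (by positivity)]
    refine congrArg iSup (funext fun x => ?_)
    rw [Finset.mul_sum]
    exact Finset.sum_congr rfl fun k _ => by ring
  set s := Real.sqrt (N * f) with hs
  have hs0 : 0 < s := Real.sqrt_pos.2 hNf
  set L := Real.sqrt (Real.log (1 / δ)) with hL
  have hL0 : 0 ≤ L := Real.sqrt_nonneg _
  set R := radExp (f * (1 - f)) (supPairing F) with hR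
  have hdev : 16 * B * (1 + L) / s ≤ 16 * B * (1 + L) / ((1 - f) * s) := by
    refine div_le_div_of_nonneg_left (by positivity) (by positivity) ?_
    nlinarith
  rw [ge_iff_le]
  rcases lt_or_ge ((N : ℝ) * f) 4 with hsmall | hlarge
  · rw [Finset.filter_true_of_mem]
    · refine mul_le_of_le_one_left (Nat.cast_nonneg _) (by linarith)
    intro S hS β hβ
    have hs2 : s ≤ 2 := by
      rw [hs, Real.sqrt_le_left (by norm_num)]
      linarith
    have htest : 1 / ((N : ℝ) - m) * ∑ k ∈ Sᶜ, ℓ (y k) ((K *ᵥ β) k) ≤ B := by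
      have h1 : ∑ k ∈ Sᶜ, ℓ (y k) ((K *ᵥ β) k) ≤ ((N : ℝ) - m) * B := by
        refine (Finset.sum_le_card_nsmul _ _ B fun k _ => (hℓ _ _ (hy k)).2).trans (le_of_eq ?_)
        rw [Finset.card_compl, (Finset.mem_powersetCard.1 hS).2, Fintype.card_fin, nsmul_eq_mul,
          Nat.cast_sub hmN.le]
      rw [one_div, inv_mul_le_iff₀ (by linarith)]
      exact h1
    have htrain : 0 ≤ 1 / (m : ℝ) * ∑ k ∈ S, ℓ (y k) ((K *ᵥ β) k) :=
      mul_nonneg (by positivity) (Finset.sum_nonneg fun k _ => (hℓ _ _ (hy k)).1)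
    have hRad : 0 ≤ 1 / (N : ℝ) * R / (ρ * (f * (1 - f))) := by positivity
    have hB' : B ≤ 16 * B * (1 + L) / s := by
      rw [le_div_iff₀ hs0]
      nlinarith [mul_nonneg hB.le hL0, mul_le_mul_of_nonneg_left hs2 hB.le]
    linarith
  · refine (card_filter_supGap_le hv hB hf0 hf1 hlarge hmN hmf hmf' hδ0 hδ1).trans
      (Nat.cast_le.2 (Finset.card_le_card fun S hS => ?_))
    simp only [Finset.mem_filter] at hS ⊢
    refine ⟨hS.1, fun β hβ => ?_⟩
    have h1 := (le_supPairing hv (fun k => if k ∈ S then -(1 / (m : ℝ)) else 1 / ((N : ℝ) - m))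
      ⟨β, hβ⟩).trans hS.2
    have h2 : ∑ k, (if k ∈ S then -(1 / (m : ℝ)) else 1 / ((N : ℝ) - m)) * v ⟨β, hβ⟩ k =
        1 / ((N : ℝ) - m) * ∑ k ∈ Sᶜ, ℓ (y k) ((K *ᵥ β) k) -
          1 / (m : ℝ) * ∑ k ∈ S, ℓ (y k) ((K *ᵥ β) k) := by
      rw [← Finset.sum_add_sum_compl S, add_comm, sub_eq_add_neg (_ * _), ← neg_mul,
        Finset.mul_sum, Finset.mul_sum]
      congr 1
      · exact Finset.sum_congr rfl fun k hk => by rw [if_neg (Finset.mem_compl.1 hk)]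
      · exact Finset.sum_congr rfl fun k hk => by rw [if_pos hk]
    have h3 : radExp (f * (1 - f)) (supPairing v) / (N * (f * (1 - f))) ≤
        1 / (N : ℝ) * R / (ρ * (f * (1 - f))) := by
      refine (div_le_div_of_nonneg_right hcontr (by positivity)).trans (le_of_eq ?_)
      field_simp
    rw [h2] at h1
    linarith
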